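/- Let (X, d) be a metric space, I : X → [0, ∞] a good rate function (lower semicontinuous with compact sublevel sets) with unique zero x₀, (a_n) positive reals with a_n → ∞, and (μ_n) Borel probability measures on X satisfying the large deviation upper bound: for every closed F ⊆ X, limsup_{n→∞} (1/a_n) log μ_n(F) ≤ −inf_{x∈F} I(x). Then μ_n converges weakly to δ_{x₀}: for every bounded continuous Φ : X → ℝ, ∫_X Φ dμ_n → Φ(x₀). -/

import Mathlib

open MeasureTheory Filter
open scoped ENNReal

/-- A lower semicontinuous function with compact sublevel sets which does not vanish on a closed
set is bounded away from zero on it. -/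
lemma LowerSemicontinuous.iInf_mem_pos_of_isClosed {X : Type*} [TopologicalSpace X]
    {I : X → ℝ≥0∞} (hI : LowerSemicontinuous I)
    (hcomp : ∀ c : ℝ≥0∞, c < ⊤ → IsCompact {x | I x ≤ c})
    {F : Set X} (hF : IsClosed F) (hpos : ∀ x ∈ F, 0 < I x) : 0 < ⨅ x ∈ F, I x := by
  have hK : IsCompact ({x | I x ≤ 1} ∩ F) := (hcomp 1 ENNReal.one_lt_top).inter_right hF
  rcases ({x | I x ≤ 1} ∩ F).eq_empty_or_nonempty with hempty | hne
  · refine one_pos.trans_le (le_iInf₂ fun x hx => ?_)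
    by_contra! hlt
    exact hempty.subset ⟨hlt.le, hx⟩
  · obtain ⟨y, ⟨hy1, hyF⟩, hmin⟩ := (hI.lowerSemicontinuousOn _).exists_isMinOn hne hK
    refine (hpos y hyF).trans_le (le_iInf₂ fun x hx => ?_)
    rcases le_total (I x) 1 with h | h
    · exact hmin ⟨h, hx⟩
    · exact le_trans hy1 h

/-- A sequence with negative exponential rate at a speed tending to infinity tends to zero. -/
lemma ENNReal.tendsto_zero_of_limsup_inv_mul_log_neg {a : ℕ → ℝ} (hapos : ∀ n, 0 < a n)
    (hatop : Tendsto a atTop atTop) {m : ℕ → ℝ≥0∞}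
    (h : limsup (fun n => (((a n)⁻¹ : ℝ) : EReal) * ENNReal.log (m n)) atTop < 0) :
    Tendsto m atTop (nhds 0) := by
  obtain ⟨y, hy, hy0⟩ := exists_between h
  obtain ⟨q, rfl⟩ := ENNReal.log_surjective y
  refine tendsto_of_tendsto_of_tendsto_of_le_of_le' tendsto_const_nhds
    ((ENNReal.tendsto_rpow_atTop_of_base_lt_one (ENNReal.log_lt_zero_iff.1 hy0)).comp hatop)
    (Eventually.of_forall fun _ => zero_le) ?_
  filter_upwards [eventually_lt_of_limsup_lt hy] with n hn
  rw [← ENNReal.log_rpow, ENNReal.log_lt_log_iff, ENNReal.rpow_inv_lt_iff (hapos n)] at hn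
  exact hn.le

/-- Let `(X, d)` be a metric space, `I` a good rate function with unique zero
`x₀`, `(a_n)` positive reals tending to `∞`, and `(μ_n)` Borel probability measures on `X`
satisfying the large deviation upper bound: for every closed `F`,
`limsup (1/a_n) log μ_n(F) ≤ −inf_F I`. Then `μ_n` converges weakly to `δ_{x₀}`: for every
bounded continuous `Φ : X → ℝ`, `∫ Φ dμ_n → Φ(x₀)`. -/
theorem stmt10 {X : Type*} [MetricSpace X] [MeasurableSpace X] [BorelSpace X]
    (I : X → ℝ≥0∞) (hlsc : LowerSemicontinuous I)
    (hcomp : ∀ c : ℝ≥0∞, c < ⊤ → IsCompact {x | I x ≤ c})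
    (x₀ : X) (hzero : ∀ x, I x = 0 ↔ x = x₀)
    (a : ℕ → ℝ) (hapos : ∀ n, 0 < a n) (hatop : Tendsto a atTop atTop)
    (μ : ℕ → Measure X) (hμ : ∀ n, IsProbabilityMeasure (μ n))
    (hub : ∀ F : Set X, IsClosed F →
      limsup (fun n => (((a n)⁻¹ : ℝ) : EReal) * ENNReal.log (μ n F)) atTop
        ≤ -((⨅ x ∈ F, I x : ℝ≥0∞) : EReal)) :
    ∀ Φ : BoundedContinuousFunction X ℝ,
      Tendsto (fun n => ∫ x, Φ x ∂(μ n)) atTop (nhds (Φ x₀)) := by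
  let ν : ℕ → ProbabilityMeasure X := fun n => ⟨μ n, hμ n⟩
  let δ : ProbabilityMeasure X := ⟨Measure.dirac x₀, inferInstance⟩
  have hweak : Tendsto ν atTop (nhds δ) := by
    refine tendsto_of_forall_isClosed_limsup_le' fun F hF => ?_
    change limsup (fun n => μ n F) atTop ≤ Measure.dirac x₀ F
    by_cases hx : x₀ ∈ F
    · rw [Measure.dirac_apply_of_mem hx]
      exact limsup_le_of_le (h := Eventually.of_forall fun _ => prob_le_one)
    · have hinf : 0 < ⨅ x ∈ F, I x := hlsc.iInf_mem_pos_of_isClosed hcomp hF fun x hxF =>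
        pos_iff_ne_zero.2 fun h0 => hx ((hzero x).1 h0 ▸ hxF)
      have hneg : -((⨅ x ∈ F, I x : ℝ≥0∞) : EReal) < 0 := by
        rw [EReal.neg_lt_comm, neg_zero]
        exact_mod_cast hinf
      rw [(ENNReal.tendsto_zero_of_limsup_inv_mul_log_neg hapos hatop
        ((hub F hF).trans_lt hneg)).limsup_eq]
      exact zero_le
  intro Φ
  simpa [ν, δ] using ProbabilityMeasure.tendsto_iff_forall_integral_tendsto.1 hweak Φ
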